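/- arXiv:2305.06316 — 2 statements merged into one kernel-verified Lean document; each statement's English description precedes it below -/
import Mathlib

section
/- Let F be a field of characteristic 2 and let a, b, c, d, c', d', x, y, y' be elements of F with b ≠ 0, satisfying the two Ptolemy relations a·d + b·y + c·x = 0 and a·d' + b·y' + c'·x = 0. Then there exists a unique element z of F satisfying the three Ptolemy relations a·z + c·y' + c'·y = 0, b·z + c·d' + c'·d = 0, and d·y' + d'·y + x·z = 0; namely z = (c·d' + c'·d)/b. (Geometrically: for a triangle with sides (a,b,x) and two inscribed quadrilaterals (a,b,c,d) and (a,b,c',d') with diagonals y and y' respectively, there exists a unique fifth edge length z completing the pentagon, giving rise to the three remaining inscribed quadrilaterals.) -/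
/-- **Completing a pentagon (uniqueness of the fifth edge).**
Let `F` be a field of characteristic 2 and let `a b c d c' d' x y y' : F` with
`b ≠ 0`, satisfying the two Ptolemy relations `a·d + b·y + c·x = 0` and
`a·d' + b·y' + c'·x = 0`.  Then there exists a unique `z : F` satisfying the
three Ptolemy relations `a·z + c·y' + c'·y = 0`, `b·z + c·d' + c'·d = 0` and
`d·y' + d'·y + x·z = 0`; namely `z = (c·d' + c'·d)/b`. -/
theorem pentagon_completion_unique {F : Type*} [Field F] [CharP F 2]
    (a b c d c' d' x y y' : F) (hb : b ≠ 0)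
    (h1 : a * d + b * y + c * x = 0)
    (h2 : a * d' + b * y' + c' * x = 0) :
    (∃! z : F, a * z + c * y' + c' * y = 0 ∧ b * z + c * d' + c' * d = 0 ∧
        d * y' + d' * y + x * z = 0) ∧
    (a * ((c * d' + c' * d) / b) + c * y' + c' * y = 0 ∧
      b * ((c * d' + c' * d) / b) + c * d' + c' * d = 0 ∧
      d * y' + d' * y + x * ((c * d' + c' * d) / b) = 0) := by
  have two : (2 : F) = 0 := CharTwo.two_eq_zero
  set w := (c * d' + c' * d) / b with hw
  have hbw : b * w = c * d' + c' * d := by rw [hw]; field_simp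
  have main : a * w + c * y' + c' * y = 0 ∧ b * w + c * d' + c' * d = 0 ∧
      d * y' + d' * y + x * w = 0 := by
    refine ⟨mul_left_cancel₀ hb ?_, ?_, mul_left_cancel₀ hb ?_⟩
    · linear_combination a * hbw + c * h2 + c' * h1 - c * c' * x * two
    · linear_combination hbw + (c * d' + c' * d) * two
    · linear_combination x * hbw + d * h2 + d' * h1 - a * d * d' * two
  refine ⟨⟨w, main, fun z hz => mul_left_cancel₀ hb ?_⟩, main⟩
  linear_combination hz.2.1 - main.2.1
end

section
/- Let F be a field of characteristic 2 and let a, b, c, d, c', d', x, y, y', z be elements of F with b ≠ 0 and z ≠ 0, satisfying the three Ptolemy relations a·z + c·y' + c'·y = 0, b·z + c·d' + c'·d = 0, and d·y' + d'·y + x·z = 0 (the relations at the vertices of the spine S' after a Matveev–Piergallini move). Then c'·x = a·d' + b·y' and b·c'·y = a·c·d' + a·c'·d + b·c·y'; that is, x and y satisfy exactly the expressions x = (a·d' + b·y')/c' and y = (a·c·d' + a·c'·d + b·c·y')/(b·c') (when c' ≠ 0) that follow from the two Ptolemy relations a·d + b·y + c·x = 0 and a·d' + b·y' + c'·x = 0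 of the spine S before the move. -/
/-- **Algebraic core of invariance under the first Matveev–Piergallini move.**
Let `F` be a field of characteristic 2 and `a b c d c' d' x y y' z : F` with
`b ≠ 0` and `z ≠ 0`, satisfying the three Ptolemy relations of the spine `S'`
after the move: `a·z + c·y' + c'·y = 0`, `b·z + c·d' + c'·d = 0`,
`d·y' + d'·y + x·z = 0`.  Then `c'·x = a·d' + b·y'` and
`b·c'·y = a·c·d' + a·c'·d + b·c·y'`; i.e. (when `c' ≠ 0`)
`x = (a·d' + b·y')/c'` and `y = (a·c·d' + a·c'·d + b·c·y')/(b·c')`, exactly the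
expressions following from the two Ptolemy relations of the spine `S` before
the move. -/
theorem matveev_piergallini_move_expressions {F : Type*} [Field F] [CharP F 2]
    (a b c d c' d' x y y' z : F) (hb : b ≠ 0) (hz : z ≠ 0)
    (h1 : a * z + c * y' + c' * y = 0)
    (h2 : b * z + c * d' + c' * d = 0)
    (h3 : d * y' + d' * y + x * z = 0) :
    c' * x = a * d' + b * y' ∧
    b * c' * y = a * c * d' + a * c' * d + b * c * y' ∧
    (c' ≠ 0 →
      x = (a * d' + b * y') / c' ∧
      y = (a * c * d' + a * c' * d + b * c * y') / (b * c')) := by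
  have two : (2 : F) = 0 := CharTwo.two_eq_zero
  have hx : c' * x = a * d' + b * y' := by
    apply mul_right_cancel₀ hz
    linear_combination c' * h3 - d' * h1 - y' * h2 + c * d' * y' * two
  have hy : b * c' * y = a * c * d' + a * c' * d + b * c * y' := by
    linear_combination b * h1 - a * h2 - b * c * y' * two
  refine ⟨hx, hy, fun hc => ⟨?_, ?_⟩⟩
  · rw [eq_div_iff hc, mul_comm, hx]
  · rw [eq_div_iff (mul_ne_zero hb hc), mul_comm, hy]
end
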